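/- Let d, d' ≥ 1, let Σ be an invertible real d'×d' matrix, let V : ℝ^d → ℝ, α : ℝ^d × ℝ^{d'} → ℝ^d, β : ℝ^d × ℝ^{d'} → ℝ^{d'} be C^∞, let h > 0, and assume the relation (★): α·∇_xV + 2β·ΣᵀΣv − (h/2)(div_x α + div_v β) = 0 on ℝ^d × ℝ^{d'}. Set ρ(v) = (C_Σ h)^{−d'/4} e^{−|Σv|²/h} with C_Σ = (π/2)(det Σ⁻¹)^{2/d'}, and for u ∈ C_c^∞(ℝ^d × ℝ^{d'}) set u_ρ(x) = ∫_{ℝ^{d'}} u(x,v')ρ(v')dv' and (Πu)(x,v) = u_ρ(x)ρ(v). Then: (i) h∇_v(Πu)(x,v) + 2ΣᵀΣv·(Πu)(x,v) = 0 for all (x,v) (i.e. ∂_{|Σv|²}(Πu) = 0); and (ii) with Xu = α·h∇_x u + β·h∇_v u + (h/2)(div_x α + div_v β) u, one has X(Πu)(x,v) = Σ_{i=1}^d α_i(x,v) ( h ∂_{x_i} u_ρ(x) + ∂_{x_i} V(x) u_ρ(x) ) ρ(v) for all (x,v), i.e. XΠ = α·∂_V Π where ∂_V = h∇_x + ∇_xV.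 -/

import Mathlib

noncomputable section

/-- Points of the phase space `ℝ^d × ℝ^{d'}`. -/
abbrev KPt (d d' : ℕ) := (Fin d → ℝ) × (Fin d' → ℝ)

/-- Partial derivative of `g` in the `i`-th position variable. -/
noncomputable def pdX (d d' : ℕ) (g : KPt d d' → ℝ) (i : Fin d) (p : KPt d d') : ℝ :=
  fderiv ℝ (fun x => g (x, p.2)) p.1 (Pi.single i 1)

/-- Partial derivative of `g` in the `j`-th velocity variable. -/
noncomputable def pdV (d d' : ℕ) (g : KPt d d' → ℝ) (j : Fin d') (p : KPt d d') : ℝ :=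
  fderiv ℝ (fun v => g (p.1, v)) p.2 (Pi.single j 1)

/-- Divergence in the position variables. -/
noncomputable def divX (d d' : ℕ) (α : KPt d d' → Fin d → ℝ) (p : KPt d d') : ℝ :=
  ∑ i, pdX d d' (fun q => α q i) i p

/-- Divergence in the velocity variables. -/
noncomputable def divV (d d' : ℕ) (β : KPt d d' → Fin d' → ℝ) (p : KPt d d') : ℝ :=
  ∑ j, pdV d d' (fun q => β q j) j p

/-- Laplacian in the velocity variables. -/
noncomputable def lapV (d d' : ℕ) (g : KPt d d' → ℝ) (p : KPt d d') : ℝ :=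
  ∑ j, pdV d d' (fun q => pdV d d' g j q) j p

open MeasureTheory

/-- The normalization constant `C_Σ = (π/2)(det Σ⁻¹)^{2/d'}`. -/
noncomputable def CSigma (d' : ℕ) (S : Matrix (Fin d') (Fin d') ℝ) : ℝ :=
  Real.pi / 2 * (S⁻¹.det) ^ ((2 : ℝ) / (d' : ℝ))

/-- The normalized Maxwellian `ρ(v) = (C_Σ h)^{−d'/4} e^{−|Σv|²/h}`. -/
noncomputable def rhoKFP (d' : ℕ) (S : Matrix (Fin d') (Fin d') ℝ) (h : ℝ)
    (v : Fin d' → ℝ) : ℝ :=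
  (CSigma d' S * h) ^ (-(d' : ℝ) / 4) * Real.exp (-(∑ j, (S.mulVec v j) ^ 2) / h)

/-- `u_ρ(x) = ∫ u(x,v') ρ(v') dv'`. -/
noncomputable def uRho (d d' : ℕ) (S : Matrix (Fin d') (Fin d') ℝ) (h : ℝ)
    (u : KPt d d' → ℝ) (x : Fin d → ℝ) : ℝ :=
  ∫ v' : Fin d' → ℝ, u (x, v') * rhoKFP d' S h v'

/-- The projector `(Πu)(x,v) = u_ρ(x) ρ(v)`. -/
noncomputable def PiProj (d d' : ℕ) (S : Matrix (Fin d') (Fin d') ℝ) (h : ℝ)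
    (u : KPt d d' → ℝ) (p : KPt d d') : ℝ :=
  uRho d d' S h u p.1 * rhoKFP d' S h p.2

/-- The transport operator
`Xu = α·h∇_x u + β·h∇_v u + (h/2)(div_x α + div_v β) u`. -/
noncomputable def Xop (d d' : ℕ) (h : ℝ) (α : KPt d d' → Fin d → ℝ)
    (β : KPt d d' → Fin d' → ℝ) (u : KPt d d' → ℝ) (p : KPt d d') : ℝ :=
  (∑ i, α p i * (h * pdX d d' u i p)) + (∑ j, β p j * (h * pdV d d' u j p))
    + h / 2 * (divX d d' α p + divV d d' β p) * u p

theorem rhoKFP_fderiv (d' : ℕ) (S : Matrix (Fin d') (Fin d') ℝ) (h : ℝ)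
    (v : Fin d' → ℝ) (j : Fin d') :
    fderiv ℝ (rhoKFP d' S h) v (Pi.single j 1)
      = -(2 * (S.transpose * S).mulVec v j) / h * rhoKFP d' S h v := by
  have hk : ∀ k : Fin d', HasFDerivAt (fun w : Fin d' → ℝ => S.mulVec w k)
      ((ContinuousLinearMap.proj (R := ℝ) (φ := fun _ : Fin d' => ℝ) k).comp
        (LinearMap.toContinuousLinearMap S.mulVecLin)) v := fun k =>
    ((ContinuousLinearMap.proj (R := ℝ) (φ := fun _ : Fin d' => ℝ) k).comp
        (LinearMap.toContinuousLinearMap S.mulVecLin)).hasFDerivAt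
  have hs := HasFDerivAt.fun_sum (u := Finset.univ) (fun k _ => (hk k).pow 2)
  have he := ((hs.neg.mul_const h⁻¹).exp).const_mul ((CSigma d' S * h) ^ (-(d' : ℝ) / 4))
  have hr : rhoKFP d' S h = fun w => (CSigma d' S * h) ^ (-(d' : ℝ) / 4) *
      Real.exp (-(∑ k, (S.mulVec w k) ^ 2) * h⁻¹) := by
    funext w; simp only [rhoKFP, div_eq_mul_inv]
  have hq : (S.transpose * S).mulVec v j = ∑ k, S.mulVec v k * S k j := by
    rw [← Matrix.mulVec_mulVec]
    simp only [Matrix.mulVec, dotProduct, Matrix.transpose_apply]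
    exact Finset.sum_congr rfl fun k _ => mul_comm _ _
  rw [hr, hq]
  refine (congrArg (fun L => L (Pi.single j (1:ℝ))) he.fderiv).trans ?_
  simp [Finset.mul_sum, Finset.sum_mul, div_eq_mul_inv]
  exact Finset.sum_congr rfl fun k _ => by ring

/-- Under the relation `(★)`, for `u ∈ C_c^∞(ℝ^d × ℝ^{d'})`:
(i) `h∇_v(Πu) + 2ΣᵀΣv·(Πu) = 0` everywhere, and
(ii) `X(Πu)(x,v) = Σ_i α_i(x,v)(h∂_{x_i}u_ρ(x) + ∂_{x_i}V(x) u_ρ(x)) ρ(v)`,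
i.e. `XΠ = α·∂_V Π` with `∂_V = h∇_x + ∇_x V`. -/
theorem stmt15 (d d' : ℕ) (hd : 1 ≤ d) (hd' : 1 ≤ d')
    (S : Matrix (Fin d') (Fin d') ℝ) (hS : IsUnit S)
    (V : (Fin d → ℝ) → ℝ) (hV : ContDiff ℝ (⊤ : ℕ∞) V)
    (α : KPt d d' → Fin d → ℝ) (hα : ContDiff ℝ (⊤ : ℕ∞) α)
    (β : KPt d d' → Fin d' → ℝ) (hβ : ContDiff ℝ (⊤ : ℕ∞) β)
    (h : ℝ) (hh : 0 < h)
    (hstar : ∀ p : KPt d d',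
      (∑ i, α p i * fderiv ℝ V p.1 (Pi.single i 1))
        + 2 * (∑ j, β p j * (S.transpose * S).mulVec p.2 j)
        - h / 2 * (divX d d' α p + divV d d' β p) = 0)
    (u : KPt d d' → ℝ) (hu : ContDiff ℝ (⊤ : ℕ∞) u)
    (husupp : HasCompactSupport u) :
    (∀ p : KPt d d', ∀ j : Fin d',
      h * pdV d d' (PiProj d d' S h u) j p
        + 2 * (S.transpose * S).mulVec p.2 j * PiProj d d' S h u p = 0) ∧
    (∀ p : KPt d d',
      Xop d d' h α β (PiProj d d' S h u) p
        = (∑ i, α p i *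
            (h * fderiv ℝ (uRho d d' S h u) p.1 (Pi.single i 1)
              + fderiv ℝ V p.1 (Pi.single i 1) * uRho d d' S h u p.1)) *
          rhoKFP d' S h p.2) := by
  have h0 : h ≠ 0 := hh.ne'
  have hpdV : ∀ p : KPt d d', ∀ j : Fin d', pdV d d' (PiProj d d' S h u) j p
      = uRho d d' S h u p.1 *
        (-(2 * (S.transpose * S).mulVec p.2 j) / h * rhoKFP d' S h p.2) := by
    intro p j
    rw [← rhoKFP_fderiv]
    have := congrFun (fderiv_const_smul_field (𝕜 := ℝ) (f := rhoKFP d' S h)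
      (uRho d d' S h u p.1)) p.2
    exact congrArg (fun L => L (Pi.single j (1:ℝ))) this
  have hpdX : ∀ p : KPt d d', ∀ i : Fin d, pdX d d' (PiProj d d' S h u) i p
      = rhoKFP d' S h p.2 * fderiv ℝ (uRho d d' S h u) p.1 (Pi.single i 1) := by
    intro p i
    have := congrFun (fderiv_const_smul_field (𝕜 := ℝ) (f := uRho d d' S h u)
      (rhoKFP d' S h p.2)) p.1
    have h2 : (fun x => PiProj d d' S h u (x, p.2))
        = rhoKFP d' S h p.2 • uRho d d' S h u := by
      funext x; simp [PiProj, mul_comm]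
    unfold pdX
    rw [h2]
    exact congrArg (fun L => L (Pi.single i (1:ℝ))) this
  refine ⟨fun p j => ?_, fun p => ?_⟩
  · rw [hpdV]; simp only [PiProj]; field_simp; ring
  · have hs := hstar p
    have e : h / 2 * (divX d d' α p + divV d d' β p)
        = (∑ i, α p i * fderiv ℝ V p.1 (Pi.single i 1))
        + 2 * (∑ j, β p j * (S.transpose * S).mulVec p.2 j) := by linarith
    have e2 : ∑ j, β p j * (h * pdV d d' (PiProj d d' S h u) j p)
        = -(2 * (∑ j, β p j * (S.transpose * S).mulVec p.2 j)) * PiProj d d' S h u p := by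
      rw [Finset.mul_sum, ← Finset.sum_neg_distrib, Finset.sum_mul]
      refine Finset.sum_congr rfl fun j _ => ?_
      rw [hpdV]; simp only [PiProj]; field_simp
    have e3 : (∑ i, α p i *
            (h * fderiv ℝ (uRho d d' S h u) p.1 (Pi.single i 1)
              + fderiv ℝ V p.1 (Pi.single i 1) * uRho d d' S h u p.1)) *
          rhoKFP d' S h p.2
        = (∑ i, α p i * (h * pdX d d' (PiProj d d' S h u) i p))
          + (∑ i, α p i * fderiv ℝ V p.1 (Pi.single i 1)) * PiProj d d' S h u p := by
      rw [Finset.sum_mul, Finset.sum_mul, ← Finset.sum_add_distrib]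
      refine Finset.sum_congr rfl fun i _ => ?_
      rw [hpdX]; simp only [PiProj]; ring
    rw [e3]
    unfold Xop
    rw [e, e2]
    ring
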